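/- Let $0<\beta<d$ and let $f\in W^{1,1}_{\mathrm{pol}}(\mathbb{S}^d)$ be nonnegative. Assume that $\widetilde{\mathcal{M}}_\beta f$ is differentiable at $\xi$ and that $\overline{\mathcal{B}(\zeta,r)}=\mathcal{B}\in\mathbf{B}_\xi^\beta$. Then for every $v\in\mathbb{R}^{d+1}$ with $v\perp\xi$ one has $\nabla\widetilde{\mathcal{M}}_\beta f(\xi)\cdot v = r^{\beta}\fint_{\mathcal{B}}\nabla f(\eta)\cdot\big({-(\eta\cdot v)\xi}+(\eta\cdot\xi)v\big)\,d\sigma(\eta)$; in particular $|\nabla\widetilde{\mathcal{M}}_\beta f(\xi)| \le r^{\beta}\fint_{\mathcal{B}}|\nabla f(\eta)|\,d\sigma(\eta)$. -/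

import Mathlib

open MeasureTheory Metric Filter Topology Asymptotics
open scoped ENNReal RealInnerProductSpace NNReal

noncomputable section

/-- Euclidean space `ℝⁿ`. -/
abbrev Euc (n : ℕ) : Type := EuclideanSpace ℝ (Fin n)

/-- The unit sphere `𝕊^d ⊆ ℝ^(d+1)`. -/
abbrev Sph (d : ℕ) : Type := Metric.sphere (0 : Euc (d + 1)) 1

/-- The north pole `𝐞 = (1,0,…,0)`. -/
def npole (d : ℕ) : Sph d :=
  ⟨EuclideanSpace.single 0 1, by
    rw [mem_sphere_zero_iff_norm, EuclideanSpace.norm_single]; norm_num⟩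

/-- The south pole `-𝐞`. -/
def spole (d : ℕ) : Sph d :=
  ⟨-(npole d : Euc (d + 1)), by
    rw [mem_sphere_zero_iff_norm, norm_neg, ← mem_sphere_zero_iff_norm]
    exact (npole d).2⟩

/-- Geodesic distance on the sphere. -/
def geodist {d : ℕ} (ξ η : Sph d) : ℝ :=
  Real.arccos ⟪(ξ : Euc (d + 1)), (η : Euc (d + 1))⟫

/-- Open geodesic ball. -/
def gball {d : ℕ} (ζ : Sph d) (r : ℝ) : Set (Sph d) := {η | geodist ζ η < r}

/-- Closed geodesic ball. -/
def gcball {d : ℕ} (ζ : Sph d) (r : ℝ) : Set (Sph d) := {η | geodist ζ η ≤ r}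

/-- Geodesic sphere (boundary of a geodesic ball). -/
def gsphere {d : ℕ} (ζ : Sph d) (r : ℝ) : Set (Sph d) := {η | geodist ζ η = r}

/-- The surface measure `σ` on `𝕊^d`, as the `d`-dimensional Hausdorff measure. -/
def sphMeasure (d : ℕ) : Measure (Sph d) :=
  Measure.comap Subtype.val (MeasureTheory.Measure.hausdorffMeasure (d : ℝ))

/-- The `(d-1)`-dimensional Hausdorff measure on `𝕊^d` (surface measure of boundaries of
geodesic balls). -/
def sphBdry (d : ℕ) : Measure (Sph d) :=
  Measure.comap Subtype.val (MeasureTheory.Measure.hausdorffMeasure ((d : ℝ) - 1))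

/-- Polar angle `θ(ξ) = d(𝐞, ξ)`. -/
def polarAngle {d : ℕ} (ξ : Sph d) : ℝ := geodist (npole d) ξ

/-- `w(ξ) = min{θ(ξ), π - θ(ξ)}`. -/
def sphWidth {d : ℕ} (ξ : Sph d) : ℝ := min (polarAngle ξ) (Real.pi - polarAngle ξ)

/-- A function on the sphere is polar if it only depends on `ξ ⬝ 𝐞`. -/
def IsPolar {d : ℕ} (f : Sph d → ℝ) : Prop :=
  ∀ ξ η : Sph d,
    ⟪(ξ : Euc (d + 1)), (npole d : Euc (d + 1))⟫ =
      ⟪(η : Euc (d + 1)), (npole d : Euc (d + 1))⟫ → f ξ = f η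

/-- The uncentered fractional Hardy–Littlewood maximal function `𝓜̃_β f` on `𝕊^d`. -/
def sphMax {d : ℕ} (β : ℝ) (f : Sph d → ℝ) (ξ : Sph d) : ℝ :=
  sSup {a | ∃ ζ : Sph d, ∃ r : ℝ, 0 < r ∧ r ≤ Real.pi ∧ geodist ζ ξ ≤ r ∧
    a = r ^ β * ⨍ η in gball ζ r, |f η| ∂(sphMeasure d)}

/-- The closed ball `B̄(ζ,r)` is a best ball for `𝓜̃_β f` at `ξ`, i.e. it contains `ξ` and
realizes the supremum defining `𝓜̃_β f (ξ)`. -/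
def IsBestBall {d : ℕ} (β : ℝ) (f : Sph d → ℝ) (ξ ζ : Sph d) (r : ℝ) : Prop :=
  0 ≤ r ∧ r ≤ Real.pi ∧ geodist ζ ξ ≤ r ∧
    sphMax β f ξ = r ^ β * ⨍ η in gball ζ r, |f η| ∂(sphMeasure d)

/-- Projection onto the tangent space of the sphere at `η`. -/
def tangProj {d : ℕ} (η : Sph d) (v : Euc (d + 1)) : Euc (d + 1) :=
  v - ⟪v, (η : Euc (d + 1))⟫ • (η : Euc (d + 1))

/-- `g` is the weak (tangential) gradient of `f` on `𝕊^d`: `g` is a.e. tangent and the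
integration-by-parts formula against restrictions of smooth test functions holds. -/
def HasWeakGrad {d : ℕ} (f : Sph d → ℝ) (g : Sph d → Euc (d + 1)) : Prop :=
  (∀ᵐ η ∂(sphMeasure d), ⟪g η, (η : Euc (d + 1))⟫ = 0) ∧
  ∀ φ : Euc (d + 1) → ℝ, ContDiff ℝ (⊤ : ℕ∞) φ →
    ∫ η, φ (η : Euc (d + 1)) • g η ∂(sphMeasure d)
      = - ∫ η, f η • tangProj η (gradient φ (η : Euc (d + 1))) ∂(sphMeasure d)
        + (d : ℝ) • ∫ η, (f η * φ (η : Euc (d + 1))) • (η : Euc (d + 1)) ∂(sphMeasure d)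

/-- `f ∈ W^{1,1}(𝕊^d)`, with weak gradient `g`. -/
def MemW11 {d : ℕ} (f : Sph d → ℝ) (g : Sph d → Euc (d + 1)) : Prop :=
  Integrable f (sphMeasure d) ∧ Integrable g (sphMeasure d) ∧ HasWeakGrad f g

/-- Convergence `f_j → f` in `W^{1,1}(𝕊^d)` (with weak gradients `g_j, g`). -/
def W11Tendsto {d : ℕ} (fj : ℕ → Sph d → ℝ) (gj : ℕ → Sph d → Euc (d + 1))
    (f : Sph d → ℝ) (g : Sph d → Euc (d + 1)) : Prop :=
  Tendsto (fun j => (∫ ξ, |fj j ξ - f ξ| ∂(sphMeasure d)) +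
    ∫ ξ, ‖gj j ξ - g ξ‖ ∂(sphMeasure d)) atTop (nhds 0)

/-- `u : 𝕊^d → ℝ` is differentiable at `ξ` with (tangential) gradient `G`. -/
def HasSphereGradAt {d : ℕ} (u : Sph d → ℝ) (G : Euc (d + 1)) (ξ : Sph d) : Prop :=
  ⟪G, (ξ : Euc (d + 1))⟫ = 0 ∧
    (fun η : Sph d => u η - u ξ - ⟪G, (η : Euc (d + 1)) - (ξ : Euc (d + 1))⟫)
      =o[nhds ξ] (fun η : Sph d => dist η ξ)

/-- The unit tangent vector at `η` pointing in the direction of the geodesic from `η` to `ζ`: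
`v(η,ζ) = (ζ - (η·ζ)η)/|ζ - (η·ζ)η|`. -/
def gdir {d : ℕ} (η ζ : Sph d) : Euc (d + 1) :=
  ‖(ζ : Euc (d + 1)) - ⟪(η : Euc (d + 1)), (ζ : Euc (d + 1))⟫ • (η : Euc (d + 1))‖⁻¹ •
    ((ζ : Euc (d + 1)) - ⟪(η : Euc (d + 1)), (ζ : Euc (d + 1))⟫ • (η : Euc (d + 1)))

/-- `S(η) = (η·v(ξ,𝐞))ξ - (η·ξ)v(ξ,𝐞)`. -/
def Svec {d : ℕ} (ξ η : Sph d) : Euc (d + 1) :=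
  ⟪(η : Euc (d + 1)), gdir ξ (npole d)⟫ • (ξ : Euc (d + 1)) -
    ⟪(η : Euc (d + 1)), (ξ : Euc (d + 1))⟫ • gdir ξ (npole d)

/-- `ζ` lies on the (closed) half great circle determined by `𝐞`, `ξ` and `-𝐞`
(the one passing through `ξ`). -/
def OnHalfGreatCircle {d : ℕ} (ξ ζ : Sph d) : Prop :=
  ∃ a b : ℝ, 0 ≤ b ∧ (ζ : Euc (d + 1)) = a • (npole d : Euc (d + 1)) +
    b • ((ξ : Euc (d + 1)) -
      ⟪(ξ : Euc (d + 1)), (npole d : Euc (d + 1))⟫ • (npole d : Euc (d + 1)))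

/-- `σ(r)` up to the constant `κ_{d-1}`: `∫₀^r (sin t)^{d-1} dt`. -/
def sinInt (d : ℕ) (r : ℝ) : ℝ := ∫ t in (0:ℝ)..r, (Real.sin t) ^ (d - 1)

/-- `σ'(r)` up to the constant `κ_{d-1}`: `(sin r)^{d-1}`. -/
def sinPow (d : ℕ) (r : ℝ) : ℝ := (Real.sin r) ^ (d - 1)

/-! ### Rotations in the plane spanned by `ξ` and `v` -/

/-- Infinitesimal rotation. -/
def rotA {n : ℕ} (ξ v x : Euc n) : Euc n := -(⟪x, v⟫) • ξ + ⟪x, ξ⟫ • v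

/-- Rotation by angle `t` in the plane spanned by `ξ` and `v`. -/
def rotR {n : ℕ} (ξ v : Euc n) (t : ℝ) (x : Euc n) : Euc n :=
  x + (Real.cos t - 1) • (⟪x, ξ⟫ • ξ + ⟪x, v⟫ • v) + Real.sin t • rotA ξ v x

section rotation

variable {n : ℕ} {ξ v : Euc n}

theorem rotR_inner_left (hξ : ‖ξ‖ = 1) (hvξ : ⟪v, ξ⟫ = 0) (t : ℝ) (x : Euc n) :
    ⟪rotR ξ v t x, ξ⟫ = Real.cos t * ⟪x, ξ⟫ - Real.sin t * ⟪x, v⟫ := by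
  have h1 : ⟪ξ, ξ⟫ = 1 := by rw [real_inner_self_eq_norm_sq, hξ]; norm_num
  simp only [rotR, rotA, inner_add_left, real_inner_smul_left, h1, hvξ]
  ring

theorem rotR_inner_right (hv : ‖v‖ = 1) (hvξ : ⟪v, ξ⟫ = 0) (t : ℝ) (x : Euc n) :
    ⟪rotR ξ v t x, v⟫ = Real.cos t * ⟪x, v⟫ + Real.sin t * ⟪x, ξ⟫ := by
  have h1 : ⟪v, v⟫ = 1 := by rw [real_inner_self_eq_norm_sq, hv]; norm_num
  have h2 : ⟪ξ, v⟫ = 0 := by rw [real_inner_comm, hvξ]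
  simp only [rotR, rotA, inner_add_left, real_inner_smul_left, h1, h2]
  ring

theorem rotR_neg_rotR (hξ : ‖ξ‖ = 1) (hv : ‖v‖ = 1) (hvξ : ⟪v, ξ⟫ = 0) (t : ℝ) (x : Euc n) :
    rotR ξ v (-t) (rotR ξ v t x) = x := by
  have key : rotR ξ v (-t) (rotR ξ v t x) = x +
      (((Real.cos t) ^ 2 + (Real.sin t) ^ 2 - 1) * ⟪x, ξ⟫) • ξ +
      (((Real.cos t) ^ 2 + (Real.sin t) ^ 2 - 1) * ⟪x, v⟫) • v := by
    rw [rotR, rotA, rotR_inner_left hξ hvξ, rotR_inner_right hv hvξ, Real.cos_neg, Real.sin_neg,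
      rotR, rotA]
    module
  rw [key, Real.cos_sq_add_sin_sq]
  simp

theorem rotR_rotR_neg (hξ : ‖ξ‖ = 1) (hv : ‖v‖ = 1) (hvξ : ⟪v, ξ⟫ = 0) (t : ℝ) (x : Euc n) :
    rotR ξ v t (rotR ξ v (-t) x) = x := by
  simpa using rotR_neg_rotR hξ hv hvξ (-t) x

theorem rotR_adjoint (t : ℝ) (x y : Euc n) :
    ⟪rotR ξ v t x, y⟫ = ⟪x, rotR ξ v (-t) y⟫ := by
  simp only [rotR, rotA, inner_add_right,
    real_inner_smul_right, Real.cos_neg, Real.sin_neg, real_inner_comm y]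
  rw [real_inner_comm ξ x, real_inner_comm v x]
  ring

theorem rotR_inner (hξ : ‖ξ‖ = 1) (hv : ‖v‖ = 1) (hvξ : ⟪v, ξ⟫ = 0) (t : ℝ) (x y : Euc n) :
    ⟪rotR ξ v t x, rotR ξ v t y⟫ = ⟪x, y⟫ := by
  rw [rotR_adjoint, rotR_neg_rotR hξ hv hvξ]

theorem rotR_norm (hξ : ‖ξ‖ = 1) (hv : ‖v‖ = 1) (hvξ : ⟪v, ξ⟫ = 0) (t : ℝ) (x : Euc n) :
    ‖rotR ξ v t x‖ = ‖x‖ := by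
  rw [norm_eq_sqrt_real_inner, rotR_inner hξ hv hvξ, ← norm_eq_sqrt_real_inner]

theorem rotR_sub (t : ℝ) (x y : Euc n) :
    rotR ξ v t x - rotR ξ v t y = rotR ξ v t (x - y) := by
  simp only [rotR, rotA, inner_sub_left]
  module

theorem rotR_zero (x : Euc n) : rotR ξ v 0 x = x := by
  simp [rotR]

theorem rotA_rotR (hξ : ‖ξ‖ = 1) (hv : ‖v‖ = 1) (hvξ : ⟪v, ξ⟫ = 0) (t : ℝ) (x : Euc n) :
    rotA ξ v (rotR ξ v t x) = - Real.sin t • (⟪x, ξ⟫ • ξ + ⟪x, v⟫ • v)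
      + Real.cos t • rotA ξ v x := by
  rw [rotA, rotR_inner_left hξ hvξ, rotR_inner_right hv hvξ, rotA]
  module

/-- The rotation commutes with its generator. -/
theorem rotR_rotA (hξ : ‖ξ‖ = 1) (hv : ‖v‖ = 1) (hvξ : ⟪v, ξ⟫ = 0) (t : ℝ) (x : Euc n) :
    rotR ξ v t (rotA ξ v x) = rotA ξ v (rotR ξ v t x) := by
  rw [rotA_rotR hξ hv hvξ]
  have h1 : ⟪ξ, ξ⟫ = 1 := by rw [real_inner_self_eq_norm_sq, hξ]; norm_num
  have h2 : ⟪v, v⟫ = 1 := by rw [real_inner_self_eq_norm_sq, hv]; norm_num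
  have h3 : ⟪ξ, v⟫ = 0 := by rw [real_inner_comm, hvξ]
  have e1 : ⟪rotA ξ v x, ξ⟫ = -⟪x, v⟫ := by
    simp only [rotA, inner_add_left, real_inner_smul_left, h1, hvξ]; ring
  have e2 : ⟪rotA ξ v x, v⟫ = ⟪x, ξ⟫ := by
    simp only [rotA, inner_add_left, real_inner_smul_left, h2, h3]; ring
  rw [rotR]
  rw [show rotA ξ v (rotA ξ v x) = -⟪rotA ξ v x, v⟫ • ξ + ⟪rotA ξ v x, ξ⟫ • v from rfl, e1, e2]
  simp only [rotA]
  module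

theorem rotR_hasDerivAt (hξ : ‖ξ‖ = 1) (hv : ‖v‖ = 1) (hvξ : ⟪v, ξ⟫ = 0) (t : ℝ) (x : Euc n) :
    HasDerivAt (fun t => rotR ξ v t x) (rotA ξ v (rotR ξ v t x)) t := by
  rw [rotA_rotR hξ hv hvξ]
  have h1 := ((Real.hasDerivAt_cos t).sub_const 1).smul_const (⟪x, ξ⟫ • ξ + ⟪x, v⟫ • v)
  have h2 := (Real.hasDerivAt_sin t).smul_const (rotA ξ v x)
  exact (h1.const_add x).add h2

theorem rotA_continuous : Continuous (rotA ξ v) := by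
  unfold rotA; fun_prop

theorem rotR_continuous : Continuous (fun p : ℝ × Euc n => rotR ξ v p.1 p.2) := by
  unfold rotR rotA; fun_prop

theorem rotR_hasFDerivAt_line (t : ℝ) (x w : Euc n) :
    HasDerivAt (fun s : ℝ => rotR ξ v t (x + s • w)) (rotR ξ v t w) 0 := by
  have : (fun s : ℝ => rotR ξ v t (x + s • w)) = fun s => rotR ξ v t x + s • rotR ξ v t w := by
    funext s
    simp only [rotR, rotA, inner_add_left, real_inner_smul_left]
    module
  rw [this]
  simpa using ((hasDerivAt_id (0:ℝ)).smul_const (rotR ξ v t w)).const_add (rotR ξ v t x)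

theorem rotR_contDiff (t : ℝ) : ContDiff ℝ (⊤ : ℕ∞) (rotR ξ v t) := by
  have h1 : ContDiff ℝ (⊤ : ℕ∞) (fun x : Euc n => ⟪x, ξ⟫) := contDiff_id.inner ℝ contDiff_const
  have h2 : ContDiff ℝ (⊤ : ℕ∞) (fun x : Euc n => ⟪x, v⟫) := contDiff_id.inner ℝ contDiff_const
  unfold rotR rotA; fun_prop

theorem rotA_norm_le (hξ : ‖ξ‖ = 1) (hvξ : ⟪v, ξ⟫ = 0) (x : Euc n) (hx : ‖x‖ = 1) :
    ‖rotA ξ v x‖ ≤ ‖v‖ := by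
  by_cases hv0 : v = 0
  · simp [rotA, hv0]
  have hvp : 0 < ‖v‖ := norm_pos_iff.2 hv0
  have h1 : ⟪ξ, ξ⟫ = 1 := by rw [real_inner_self_eq_norm_sq, hξ]; norm_num
  have h2 : ⟪v, v⟫ = ‖v‖ ^ 2 := real_inner_self_eq_norm_sq v
  have h3 : ⟪ξ, v⟫ = 0 := by rw [real_inner_comm, hvξ]
  have hxx : ⟪x, x⟫ = 1 := by rw [real_inner_self_eq_norm_sq, hx]; norm_num
  have e : ‖rotA ξ v x‖ ^ 2 = ⟪x, v⟫ ^ 2 + ⟪x, ξ⟫ ^ 2 * ‖v‖ ^ 2 := by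
    rw [← real_inner_self_eq_norm_sq]
    simp only [rotA, inner_add_left, real_inner_smul_left, inner_add_right,
      real_inner_smul_right, h1, h2, h3, hvξ]
    ring
  have b : 0 ≤ ‖x - ⟪x, ξ⟫ • ξ - (⟪x, v⟫ / ‖v‖ ^ 2) • v‖ ^ 2 := sq_nonneg _
  rw [← real_inner_self_eq_norm_sq] at b
  simp only [inner_sub_left, real_inner_smul_left, inner_sub_right,
      real_inner_smul_right, h1, h2, h3, hvξ, hxx, real_inner_comm x] at b
  have b2 : ⟪x, v⟫ ^ 2 / ‖v‖ ^ 2 ≤ 1 - ⟪x, ξ⟫ ^ 2 := by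
    have : (⟪x, v⟫ / ‖v‖ ^ 2) * ‖v‖ ^ 2 = ⟪x, v⟫ := by field_simp
    have h' : (⟪x, v⟫ / ‖v‖ ^ 2) * ⟪x, v⟫ = ⟪x, v⟫ ^ 2 / ‖v‖ ^ 2 := by ring
    rw [this] at b
    rw [← h']
    linarith
  rw [div_le_iff₀ (by positivity)] at b2
  apply le_of_sq_le_sq _ hvp.le
  rw [e]; nlinarith

end rotation

/-! ### The surface measure -/

theorem sphMeasure_eq (d : ℕ) :
    sphMeasure d = (MeasureTheory.Measure.hausdorffMeasure (d : ℝ) : Measure (Sph d)) := by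
  ext s hs
  rw [sphMeasure, (MeasurableEmbedding.subtype_coe
    (Metric.isClosed_sphere.measurableSet)).comap_apply]
  exact isometry_subtype_coe.hausdorffMeasure_image (Or.inl (by positivity)) s

theorem normalize_lipschitz (n : ℕ) :
    LipschitzOnWith 2 (fun x : Euc n => ‖x‖⁻¹ • x) {x | 1 ≤ ‖x‖} := by
  apply LipschitzOnWith.of_dist_le_mul
  intro x hx y hy
  simp only [Set.mem_ofPred_eq] at hx hy
  have hx0 : ‖x‖ ≠ 0 := by positivity
  have hy0 : ‖y‖ ≠ 0 := by positivity
  rw [dist_eq_norm, dist_eq_norm]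
  have e : ‖x‖⁻¹ • x - ‖y‖⁻¹ • y = ‖x‖⁻¹ • (x - y) + (‖x‖⁻¹ - ‖y‖⁻¹) • y := by module
  have h1 : ‖‖x‖⁻¹ • (x - y)‖ ≤ ‖x - y‖ := by
    rw [norm_smul, norm_inv, norm_norm]
    exact mul_le_of_le_one_left (norm_nonneg _) (inv_le_one_of_one_le₀ hx)
  have h2 : ‖(‖x‖⁻¹ - ‖y‖⁻¹) • y‖ ≤ ‖x - y‖ := by
    rw [norm_smul, Real.norm_eq_abs]
    have : ‖x‖⁻¹ - ‖y‖⁻¹ = ‖x‖⁻¹ * ‖y‖⁻¹ * (‖y‖ - ‖x‖) := by field_simp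
    rw [this, abs_mul, abs_of_nonneg (by positivity)]
    have h3 : |‖y‖ - ‖x‖| ≤ ‖x - y‖ := by
      rw [norm_sub_rev]; exact abs_norm_sub_norm_le y x
    calc ‖x‖⁻¹ * ‖y‖⁻¹ * |‖y‖ - ‖x‖| * ‖y‖ = ‖x‖⁻¹ * |‖y‖ - ‖x‖| := by field_simp
      _ ≤ 1 * ‖x - y‖ := by
        gcongr
        exact inv_le_one_of_one_le₀ hx
      _ = _ := one_mul _
  rw [e]
  calc _ ≤ _ := norm_add_le _ _
    _ ≤ ‖x - y‖ + ‖x - y‖ := add_le_add h1 h2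
    _ = _ := by push_cast; ring

theorem sphere_hausdorff_lt_top (d : ℕ) :
    (MeasureTheory.Measure.hausdorffMeasure (d : ℝ) : Measure (Euc (d + 1)))
      (Metric.sphere 0 1) < ∞ := by
  let I : Fin (d + 1) → ℝ → (Fin d → ℝ) → Euc (d + 1) := fun i s y =>
    WithLp.toLp 2 (Fin.insertNth (α := fun _ => ℝ) i s y)
  let F : Fin (d + 1) → ℝ → (Fin d → ℝ) → Euc (d + 1) := fun i s y => ‖I i s y‖⁻¹ • I i s y
  have hI : ∀ i s, ∃ K : ℝ≥0, LipschitzWith K (I i s) := by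
    intro i s
    have h1 : LipschitzWith 1 (fun y : Fin d → ℝ => Fin.insertNth (α := fun _ => ℝ) i s y) := by
      apply LipschitzWith.of_dist_le_mul
      intro x y
      rw [NNReal.coe_one, one_mul, dist_pi_le_iff dist_nonneg]
      intro j
      refine Fin.succAboveCases i ?_ (fun k => ?_) j
      · simp
      · simpa using dist_le_pi_dist x y k
    have h2 := (PiLp.lipschitzWith_toLp 2 (fun _ : Fin (d + 1) => ℝ)).comp h1
    exact ⟨_, h2⟩
  have hIn : ∀ i s y, |s| = 1 → 1 ≤ ‖I i s y‖ := by
    intro i s y hs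
    have := PiLp.norm_apply_le (I i s y) i
    simpa [I, hs] using this
  have hF : ∀ i s, |s| = 1 →
      (MeasureTheory.Measure.hausdorffMeasure (d : ℝ) : Measure (Euc (d + 1)))
        (F i s '' (Metric.closedBall 0 1)) < ∞ := by
    intro i s hs
    obtain ⟨K, hK⟩ := hI i s
    have hL : LipschitzOnWith (2 * K) (F i s) (Metric.closedBall 0 1) :=
      (normalize_lipschitz (d + 1)).comp (hK.lipschitzOnWith (s := Metric.closedBall 0 1))
        (fun y _ => hIn i s y hs)
    refine lt_of_le_of_lt (hL.hausdorffMeasure_image_le (by positivity)) ?_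
    refine ENNReal.mul_lt_top (ENNReal.rpow_lt_top_of_nonneg (by positivity) ENNReal.coe_ne_top) ?_
    have := hausdorffMeasure_pi_real (ι := Fin d)
    rw [Fintype.card_fin] at this
    rw [this]
    exact measure_closedBall_lt_top
  have hcov : (Metric.sphere 0 1 : Set (Euc (d + 1))) ⊆
      ⋃ i : Fin (d + 1), (F i 1 '' (Metric.closedBall 0 1) ∪ F i (-1) '' (Metric.closedBall 0 1)) := by
    intro x hx
    rw [mem_sphere_zero_iff_norm] at hx
    obtain ⟨i, hi⟩ := Finite.exists_max (fun i => |x i|)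
    have hpos : 0 < |x i| := by
      by_contra hcon
      have : x = 0 := by
        ext j
        have h1 := hi j
        have h2 := abs_nonneg (x j)
        have : |x j| = 0 := by linarith [not_lt.1 hcon]
        simpa using this
      rw [this] at hx
      simp at hx
    have hball : (fun k => |x i|⁻¹ * x (i.succAbove k)) ∈ Metric.closedBall (0 : Fin d → ℝ) 1 := by
      rw [mem_closedBall_zero_iff, pi_norm_le_iff_of_nonneg zero_le_one]
      intro k
      rw [norm_mul, norm_inv, Real.norm_eq_abs, abs_abs, Real.norm_eq_abs, inv_mul_le_one₀ hpos]
      exact hi _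
    have hmain : ∀ s, x i = s * |x i| →
        x = F i s (fun k => |x i|⁻¹ * x (i.succAbove k)) := by
      intro s hs
      have hI' : I i s (fun k => |x i|⁻¹ * x (i.succAbove k)) = |x i|⁻¹ • x := by
        ext j
        refine Fin.succAboveCases i ?_ (fun k => ?_) j
        · simp only [I, Fin.insertNth_apply_same, PiLp.smul_apply, smul_eq_mul]
          field_simp
          linarith
        · simp [I]
      simp only [F, hI']
      rw [norm_smul, hx, norm_inv, Real.norm_eq_abs, abs_abs, mul_one, inv_inv, smul_smul,
        mul_inv_cancel₀ hpos.ne', one_smul]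
    refine Set.mem_iUnion.2 ⟨i, ?_⟩
    rcases le_total 0 (x i) with h | h
    · left
      exact ⟨_, hball, (hmain 1 (by rw [abs_of_nonneg h]; ring)).symm⟩
    · right
      exact ⟨_, hball, (hmain (-1) (by rw [abs_of_nonpos h]; ring)).symm⟩
  refine lt_of_le_of_lt (measure_mono hcov) ?_
  refine lt_of_le_of_lt (measure_iUnion_fintype_le _ _) ?_
  refine ENNReal.sum_lt_top.2 (fun i _ => ?_)
  exact lt_of_le_of_lt (measure_union_le _ _)
    (ENNReal.add_lt_top.2 ⟨hF i 1 (by simp), hF i (-1) (by simp)⟩)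

instance sphMeasure_finite (d : ℕ) : IsFiniteMeasure (sphMeasure d) := by
  constructor
  rw [sphMeasure, (MeasurableEmbedding.subtype_coe
    (Metric.isClosed_sphere.measurableSet)).comap_apply]
  rw [Set.image_univ, Subtype.range_coe]
  exact sphere_hausdorff_lt_top d

/-- The rotation as an isometric equivalence of the sphere. -/
def rotE {d : ℕ} (ξ v : Euc (d + 1)) (hξ : ‖ξ‖ = 1) (hv : ‖v‖ = 1) (hvξ : ⟪v, ξ⟫ = 0) (t : ℝ) :
    Sph d ≃ᵢ Sph d where
  toFun x := ⟨rotR ξ v t x, by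
    rw [mem_sphere_zero_iff_norm, rotR_norm hξ hv hvξ, ← mem_sphere_zero_iff_norm]; exact x.2⟩
  invFun x := ⟨rotR ξ v (-t) x, by
    rw [mem_sphere_zero_iff_norm, rotR_norm hξ hv hvξ, ← mem_sphere_zero_iff_norm]; exact x.2⟩
  left_inv x := Subtype.ext (rotR_neg_rotR hξ hv hvξ t x)
  right_inv x := Subtype.ext (rotR_rotR_neg hξ hv hvξ t x)
  isometry_toFun := by
    apply Isometry.of_dist_eq
    intro x y
    rw [Subtype.dist_eq, Subtype.dist_eq, dist_eq_norm, dist_eq_norm, rotR_sub,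
      rotR_norm hξ hv hvξ]

theorem rotE_mp {d : ℕ} (ξ v : Euc (d + 1)) (hξ : ‖ξ‖ = 1) (hv : ‖v‖ = 1) (hvξ : ⟪v, ξ⟫ = 0)
    (t : ℝ) : MeasurePreserving (rotE ξ v hξ hv hvξ t) (sphMeasure d) (sphMeasure d) := by
  rw [sphMeasure_eq]
  exact (rotE ξ v hξ hv hvξ t).measurePreserving_hausdorffMeasure _

theorem gball_eq {d : ℕ} (ζ : Sph d) {r : ℝ} (h0 : 0 ≤ r) (hr : r ≤ Real.pi) :
    gball ζ r = {η : Sph d | Real.cos r < ⟪(ζ : Euc (d + 1)), (η : Euc (d + 1))⟫} := by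
  ext η
  simp only [gball, geodist, Set.mem_ofPred_eq]
  have h1 : |⟪(ζ : Euc (d + 1)), (η : Euc (d + 1))⟫| ≤ 1 := by
    have := abs_real_inner_le_norm (ζ : Euc (d + 1)) (η : Euc (d + 1))
    rwa [mem_sphere_zero_iff_norm.1 ζ.2, mem_sphere_zero_iff_norm.1 η.2, one_mul] at this
  rw [abs_le] at h1
  conv_rhs => rw [← Real.cos_arccos h1.1 h1.2]
  exact (Real.strictAntiOn_cos.lt_iff_gt ⟨h0, hr⟩
    ⟨Real.arccos_nonneg _, Real.arccos_le_pi _⟩).symm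

theorem gball_measurable {d : ℕ} (ζ : Sph d) {r : ℝ} (h0 : 0 ≤ r) (hr : r ≤ Real.pi) :
    MeasurableSet (gball ζ r) := by
  rw [gball_eq ζ h0 hr]
  refine IsOpen.measurableSet (isOpen_lt continuous_const ?_)
  fun_prop

theorem rotE_preimage {d : ℕ} (ξ v : Euc (d + 1)) (hξ : ‖ξ‖ = 1) (hv : ‖v‖ = 1)
    (hvξ : ⟪v, ξ⟫ = 0) (t : ℝ) (ζ : Sph d) (r : ℝ) :
    rotE ξ v hξ hv hvξ t ⁻¹' (gball (rotE ξ v hξ hv hvξ t ζ) r) = gball ζ r := by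
  ext η
  simp only [gball, geodist, Set.mem_preimage, Set.mem_ofPred_eq]
  have : ⟪((rotE ξ v hξ hv hvξ t ζ : Sph d) : Euc (d + 1)),
      ((rotE ξ v hξ hv hvξ t η : Sph d) : Euc (d + 1))⟫ = ⟪(ζ : Euc (d + 1)), (η : Euc (d + 1))⟫ :=
    rotR_inner hξ hv hvξ t _ _
  rw [this]

/-! ### The weak formula for infinitesimal rotations -/

theorem integrable_cont_smul {d : ℕ} {E : Type*} [NormedAddCommGroup E] [NormedSpace ℝ E]
    {F : Sph d → E} (hF : Integrable F (sphMeasure d)) {k : Sph d → ℝ} (hk : Continuous k) :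
    Integrable (fun η => k η • F η) (sphMeasure d) := by
  obtain ⟨C, hC⟩ := isCompact_univ.exists_bound_of_continuousOn hk.continuousOn
  exact hF.bdd_smul C hk.aestronglyMeasurable (Eventually.of_forall fun x => hC x (Set.mem_univ _))

theorem integrable_smul_cont {d : ℕ} {E : Type*} [NormedAddCommGroup E] [NormedSpace ℝ E]
    {f : Sph d → ℝ} (hf : Integrable f (sphMeasure d)) {k : Sph d → E} (hk : Continuous k) :
    Integrable (fun η => f η • k η) (sphMeasure d) := by
  obtain ⟨C, hC⟩ := isCompact_univ.exists_bound_of_continuousOn hk.continuousOn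
  exact hf.smul_of_top_left (memLp_top_of_bound hk.aestronglyMeasurable C
    (Eventually.of_forall fun x => hC x (Set.mem_univ _)))

theorem integrable_inner_cont {d : ℕ} {g : Sph d → Euc (d + 1)}
    (hg : Integrable g (sphMeasure d)) {k : Sph d → Euc (d + 1)} (hk : Continuous k) :
    Integrable (fun η => ⟪g η, k η⟫) (sphMeasure d) := by
  obtain ⟨C, hC⟩ := isCompact_univ.exists_bound_of_continuousOn hk.continuousOn
  refine (hg.norm.mul_const C).mono' (hg.1.inner hk.aestronglyMeasurable)
    (Eventually.of_forall fun x => ?_)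
  refine (norm_inner_le_norm _ _).trans ?_
  gcongr
  exact hC x (Set.mem_univ _)

theorem weak_component {d : ℕ} {f : Sph d → ℝ} {g : Sph d → Euc (d + 1)} (hf : MemW11 f g)
    (φ : Euc (d + 1) → ℝ) (hφ : ContDiff ℝ (⊤ : ℕ∞) φ) (w : Euc (d + 1)) :
    ∫ η, φ (η : Euc (d + 1)) * ⟪g η, w⟫ ∂(sphMeasure d) =
      - ∫ η, f η * (fderiv ℝ φ (η : Euc (d + 1)) w -
          fderiv ℝ φ (η : Euc (d + 1)) (η : Euc (d + 1)) * ⟪(η : Euc (d + 1)), w⟫) ∂(sphMeasure d)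
      + d * ∫ η, f η * (φ (η : Euc (d + 1)) * ⟪(η : Euc (d + 1)), w⟫) ∂(sphMeasure d) := by
  obtain ⟨hfi, hgi, -, hw⟩ := hf
  have hc : Continuous (fun η : Sph d => φ (η : Euc (d + 1))) :=
    hφ.continuous.comp continuous_subtype_val
  have hd : Continuous (fun x : Euc (d + 1) => fderiv ℝ φ x) := hφ.continuous_fderiv (by simp)
  have hgr : Continuous (fun x : Euc (d + 1) => gradient φ x) :=
    (InnerProductSpace.toDual ℝ (Euc (d + 1))).symm.continuous.comp hd
  have ht : Continuous (fun η : Sph d => tangProj η (gradient φ (η : Euc (d + 1)))) := by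
    unfold tangProj
    have := hgr.comp (continuous_subtype_val (p := fun x => x ∈ Metric.sphere (0 : Euc (d + 1)) 1))
    simp only [Function.comp_def] at this
    fun_prop
  have hi3 : Integrable (fun η : Sph d => (f η * φ (η : Euc (d + 1))) • (η : Euc (d + 1)))
      (sphMeasure d) :=
    integrable_smul_cont (f := fun η : Sph d => f η * φ (η : Euc (d + 1)))
      (integrable_smul_cont hfi hc) continuous_subtype_val
  have h := congrArg (fun z => ⟪w, z⟫) (hw φ hφ)
  simp only [inner_add_right, inner_neg_right, real_inner_smul_right] at h
  rw [← integral_inner (integrable_cont_smul hgi hc), ← integral_inner (integrable_smul_cont hfi ht),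
    ← integral_inner hi3] at h
  convert h using 1
  · refine integral_congr_ae (Eventually.of_forall fun η => ?_)
    simp only [real_inner_smul_right, real_inner_comm w]
  · congr 2
    · refine integral_congr_ae (Eventually.of_forall fun η => ?_)
      simp only [real_inner_smul_right, tangProj, inner_sub_right]
      rw [real_inner_comm _ w, inner_gradient_left, inner_gradient_left, real_inner_comm w]
    · refine integral_congr_ae (Eventually.of_forall fun η => ?_)
      simp only [real_inner_smul_right]
      rw [real_inner_comm w]; ring

theorem weak_rot {d : ℕ} {f : Sph d → ℝ} {g : Sph d → Euc (d + 1)} (hf : MemW11 f g)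
    (ξ v : Euc (d + 1)) (ψ : Euc (d + 1) → ℝ) (hψ : ContDiff ℝ (⊤ : ℕ∞) ψ) :
    ∫ η, ψ (η : Euc (d + 1)) * ⟪g η, rotA ξ v η⟫ ∂(sphMeasure d) =
      - ∫ η, f η * fderiv ℝ ψ (η : Euc (d + 1)) (rotA ξ v η) ∂(sphMeasure d) := by
  have hin : ∀ a : Euc (d + 1), ContDiff ℝ (⊤ : ℕ∞) (fun x : Euc (d + 1) => ⟪x, a⟫) :=
    fun a => contDiff_id.inner ℝ contDiff_const
  have hc : Continuous (fun η : Sph d => ψ (η : Euc (d + 1))) :=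
    hψ.continuous.comp continuous_subtype_val
  have hd : Continuous (fun x : Sph d => fderiv ℝ ψ (x : Euc (d + 1))) :=
    (hψ.continuous_fderiv (by simp)).comp continuous_subtype_val
  have hfd : ∀ a x w : Euc (d + 1), fderiv ℝ (fun x => ψ x * ⟪x, a⟫) x w =
      ψ x * ⟪w, a⟫ + ⟪x, a⟫ * fderiv ℝ ψ x w := by
    intro a x w
    have h1 : HasFDerivAt ψ (fderiv ℝ ψ x) x :=
      (hψ.differentiable (by simp) x).hasFDerivAt
    have h2 : HasFDerivAt (fun x : Euc (d + 1) => ⟪x, a⟫) (innerSL ℝ a) x := by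
      have := (innerSL ℝ a).hasFDerivAt (x := x)
      refine this.congr_of_eventuallyEq (Eventually.of_forall fun y => ?_)
      simp [real_inner_comm]
    have h3 : HasFDerivAt (fun x : Euc (d + 1) => ψ x * ⟪x, a⟫) _ x := h1.mul h2
    rw [h3.fderiv]
    simp [real_inner_comm w]
  have e1 := weak_component hf (fun x => ψ x * ⟪x, ξ⟫) (hψ.mul (hin ξ)) v
  have e2 := weak_component hf (fun x => ψ x * ⟪x, v⟫) (hψ.mul (hin v)) ξ
  simp only [hfd] at e1 e2
  obtain ⟨hfi, hgi, -, -⟩ := hf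
  have i1 : ∀ a w : Euc (d + 1), Integrable (fun η : Sph d =>
      ψ (η : Euc (d + 1)) * ⟪(η : Euc (d + 1)), a⟫ * ⟪g η, w⟫) (sphMeasure d) := fun a w =>
    integrable_cont_smul (integrable_inner_cont hgi continuous_const)
      (k := fun η : Sph d => ψ (η : Euc (d + 1)) * ⟪(η : Euc (d + 1)), a⟫) (by fun_prop)
  have i2 : ∀ a w : Euc (d + 1), Integrable (fun η : Sph d => f η *
      (ψ (η : Euc (d + 1)) * ⟪w, a⟫ + ⟪(η : Euc (d + 1)), a⟫ * fderiv ℝ ψ (η : Euc (d + 1)) w -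
        (ψ (η : Euc (d + 1)) * ⟪(η : Euc (d + 1)), a⟫ +
          ⟪(η : Euc (d + 1)), a⟫ * fderiv ℝ ψ (η : Euc (d + 1)) (η : Euc (d + 1))) *
          ⟪(η : Euc (d + 1)), w⟫)) (sphMeasure d) := fun a w =>
    integrable_smul_cont hfi (by fun_prop)
  have key : ∫ η, ψ (η : Euc (d + 1)) * ⟪g η, rotA ξ v η⟫ ∂(sphMeasure d) =
      (∫ η, ψ (η : Euc (d + 1)) * ⟪(η : Euc (d + 1)), ξ⟫ * ⟪g η, v⟫ ∂(sphMeasure d)) -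
      ∫ η, ψ (η : Euc (d + 1)) * ⟪(η : Euc (d + 1)), v⟫ * ⟪g η, ξ⟫ ∂(sphMeasure d) := by
    rw [← integral_sub (i1 _ _) (i1 _ _)]
    refine integral_congr_ae (Eventually.of_forall fun η => ?_)
    simp only [rotA, inner_add_right, real_inner_smul_right]
    ring
  have e3 : ∫ η : Sph d, f η * (ψ (η : Euc (d + 1)) * ⟪(η : Euc (d + 1)), ξ⟫ *
        ⟪(η : Euc (d + 1)), v⟫) ∂(sphMeasure d) =
      ∫ η : Sph d, f η * (ψ (η : Euc (d + 1)) * ⟪(η : Euc (d + 1)), v⟫ *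
        ⟪(η : Euc (d + 1)), ξ⟫) ∂(sphMeasure d) :=
    integral_congr_ae (Eventually.of_forall fun η => by ring)
  rw [key, e1, e2, e3]
  have : ∀ a b c : ℝ, -a + c - (-b + c) = -(a - b) := by intros; ring
  rw [this, ← integral_sub (i2 _ _) (i2 _ _)]
  congr 1
  refine integral_congr_ae (Eventually.of_forall fun η => ?_)
  simp only [rotA, map_add, map_smul, smul_eq_mul, real_inner_comm ξ v]
  ring

/-! ### Differentiating integrals over rotated balls -/

section derivs

variable {d : ℕ} {f : Sph d → ℝ} {g : Sph d → Euc (d + 1)} {ξ v : Euc (d + 1)}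

theorem fderiv_comp_rotR {φ : Euc (d + 1) → ℝ} (hφ : ContDiff ℝ (⊤ : ℕ∞) φ) (t : ℝ)
    (x w : Euc (d + 1)) :
    fderiv ℝ (fun y => φ (rotR ξ v t y)) x w = fderiv ℝ φ (rotR ξ v t x) (rotR ξ v t w) := by
  have hψ : ContDiff ℝ (⊤ : ℕ∞) (fun y => φ (rotR ξ v t y)) := hφ.comp (rotR_contDiff t)
  have hl : HasDerivAt (fun s : ℝ => x + s • w) w 0 := by
    simpa using ((hasDerivAt_id (0:ℝ)).smul_const w).const_add x
  have h1 : HasDerivAt (fun s : ℝ => φ (rotR ξ v t (x + s • w)))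
      (fderiv ℝ (fun y => φ (rotR ξ v t y)) x w) 0 := by
    have : HasFDerivAt (fun y => φ (rotR ξ v t y)) (fderiv ℝ (fun y => φ (rotR ξ v t y)) x)
        (x + (0 : ℝ) • w) := by
      simpa using (hψ.differentiable (by simp) x).hasFDerivAt
    exact HasFDerivAt.comp_hasDerivAt (f := fun s : ℝ => x + s • w) (0 : ℝ) this hl
  have h2 : HasDerivAt (fun s : ℝ => φ (rotR ξ v t (x + s • w)))
      (fderiv ℝ φ (rotR ξ v t x) (rotR ξ v t w)) 0 := by
    have : HasFDerivAt φ (fderiv ℝ φ (rotR ξ v t x)) (rotR ξ v t (x + (0 : ℝ) • w)) := by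
      simpa using (hφ.differentiable (by simp) (rotR ξ v t x)).hasFDerivAt
    exact this.comp_hasDerivAt (0 : ℝ) (rotR_hasFDerivAt_line t x w)
  exact h1.unique h2

theorem smooth_rot_hasDerivAt (hf : MemW11 f g) (hξ : ‖ξ‖ = 1) (hv : ‖v‖ = 1)
    (hvξ : ⟪v, ξ⟫ = 0) {φ : Euc (d + 1) → ℝ} (hφ : ContDiff ℝ (⊤ : ℕ∞) φ) (t : ℝ) :
    HasDerivAt (fun t => ∫ η : Sph d, f η * φ (rotR ξ v (-t) η) ∂(sphMeasure d))
      (∫ η : Sph d, ⟪g η, rotA ξ v η⟫ * φ (rotR ξ v (-t) η) ∂(sphMeasure d)) t := by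
  have hw := weak_rot hf ξ v (fun y => φ (rotR ξ v (-t) y)) (hφ.comp (rotR_contDiff (-t)))
  have e : ∫ η : Sph d, ⟪g η, rotA ξ v η⟫ * φ (rotR ξ v (-t) η) ∂(sphMeasure d) =
      ∫ η : Sph d, f η * (- (fderiv ℝ φ (rotR ξ v (-t) η) (rotA ξ v (rotR ξ v (-t) η))))
        ∂(sphMeasure d) := by
    simp only [fderiv_comp_rotR hφ, rotR_rotA hξ hv hvξ] at hw
    rw [← integral_neg] at hw
    simp only [mul_neg]
    rw [← hw]
    refine integral_congr_ae (Eventually.of_forall fun η => by ring)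
  rw [e]
  have hfi := hf.1
  have hfd : Continuous (fderiv ℝ φ) := hφ.continuous_fderiv (by simp)
  have hφc := hφ.continuous
  have hA : Continuous (rotA ξ v) := rotA_continuous
  have hk : Continuous (fun x : Euc (d + 1) => fderiv ℝ φ x (rotA ξ v x)) := by fun_prop
  obtain ⟨C, hC⟩ := (isCompact_sphere (0 : Euc (d + 1)) 1).exists_bound_of_continuousOn
    hk.continuousOn
  have hR : ∀ t, Continuous (fun η : Sph d => rotR ξ v t η) := fun t =>
    (rotR_contDiff t).continuous.comp continuous_subtype_val
  refine (hasDerivAt_integral_of_dominated_loc_of_deriv_le (s := Set.univ)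
    (F := fun t (η : Sph d) => f η * φ (rotR ξ v (-t) η))
    (F' := fun t (η : Sph d) =>
      f η * (- (fderiv ℝ φ (rotR ξ v (-t) η) (rotA ξ v (rotR ξ v (-t) η)))))
    (bound := fun η => ‖f η‖ * C) Filter.univ_mem
    (Eventually.of_forall fun s => ?_) ?_ ?_ ?_ (hfi.norm.mul_const C) ?_).2
  · exact (integrable_smul_cont hfi (hφc.comp (hR (-s)))).1
  · exact integrable_smul_cont hfi (hφc.comp (hR (-t)))
  · exact (integrable_smul_cont hfi (hk.comp (hR (-t))).neg).1
  · refine Eventually.of_forall fun η s _ => ?_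
    rw [norm_mul, norm_neg]
    gcongr
    apply hC
    rw [mem_sphere_zero_iff_norm, rotR_norm hξ hv hvξ, ← mem_sphere_zero_iff_norm]
    exact η.2
  · refine Eventually.of_forall fun η s _ => ?_
    have h1 := (rotR_hasDerivAt hξ hv hvξ (-s) (η : Euc (d + 1))).scomp s (hasDerivAt_neg s)
    have h2 : HasFDerivAt φ (fderiv ℝ φ (rotR ξ v (-s) η)) (rotR ξ v (-s) η) :=
      (hφ.differentiable (by simp) _).hasFDerivAt
    have h3 := (h2.comp_hasDerivAt s h1).const_mul (f η)
    simpa using h3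

theorem smooth_rot_integral (hf : MemW11 f g) (hξ : ‖ξ‖ = 1) (hv : ‖v‖ = 1)
    (hvξ : ⟪v, ξ⟫ = 0) {φ : Euc (d + 1) → ℝ} (hφ : ContDiff ℝ (⊤ : ℕ∞) φ) :
    Continuous (fun s : ℝ =>
      ∫ η : Sph d, ⟪g η, rotA ξ v η⟫ * φ (rotR ξ v (-s) η) ∂(sphMeasure d)) ∧
    ∀ t : ℝ, ∫ s in (0:ℝ)..t,
      (∫ η : Sph d, ⟪g η, rotA ξ v η⟫ * φ (rotR ξ v (-s) η) ∂(sphMeasure d)) =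
      (∫ η : Sph d, f η * φ (rotR ξ v (-t) η) ∂(sphMeasure d)) -
        ∫ η : Sph d, f η * φ (rotR ξ v (-0) η) ∂(sphMeasure d) := by
  have hh : Integrable (fun η : Sph d => ⟪g η, rotA ξ v η⟫) (sphMeasure d) :=
    integrable_inner_cont hf.2.1 (rotA_continuous.comp continuous_subtype_val)
  have hφc := hφ.continuous
  obtain ⟨C, hC⟩ := (isCompact_sphere (0 : Euc (d + 1)) 1).exists_bound_of_continuousOn
    hφc.continuousOn
  have hR : ∀ t, Continuous (fun η : Sph d => rotR ξ v t η) := fun t =>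
    (rotR_contDiff t).continuous.comp continuous_subtype_val
  have hcont : Continuous (fun s : ℝ =>
      ∫ η : Sph d, ⟪g η, rotA ξ v η⟫ * φ (rotR ξ v (-s) η) ∂(sphMeasure d)) := by
    refine continuous_of_dominated (bound := fun η => ‖⟪g η, rotA ξ v η⟫‖ * C) (fun s => ?_)
      (fun s => Eventually.of_forall fun η => ?_) (hh.norm.mul_const C)
      (Eventually.of_forall fun η => ?_)
    · exact (integrable_smul_cont hh (hφc.comp (hR (-s)))).1
    · rw [norm_mul]
      gcongr
      apply hC
      rw [mem_sphere_zero_iff_norm, rotR_norm hξ hv hvξ, ← mem_sphere_zero_iff_norm]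
      exact η.2
    · refine continuous_const.mul (hφc.comp ?_)
      exact rotR_continuous.comp (continuous_neg.prodMk continuous_const)
  refine ⟨hcont, fun t => ?_⟩
  exact intervalIntegral.integral_eq_sub_of_hasDerivAt
    (fun s _ => smooth_rot_hasDerivAt hf hξ hv hvξ hφ s) (hcont.intervalIntegrable _ _)

/-- Smooth approximations of the indicator of a ball. -/
def bump (ζ : Euc (d + 1)) (r : ℝ) (m : ℕ) (x : Euc (d + 1)) : ℝ :=
  Real.smoothTransition ((m : ℝ) * (⟪ζ, x⟫ - Real.cos r))

theorem bump_contDiff (ζ : Euc (d + 1)) (r : ℝ) (m : ℕ) :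
    ContDiff ℝ (⊤ : ℕ∞) (bump ζ r m) := by
  have h1 : ContDiff ℝ (⊤ : ℕ∞) (fun x : Euc (d + 1) => ⟪ζ, x⟫) := contDiff_const.inner ℝ contDiff_id
  exact Real.smoothTransition.contDiff.comp (contDiff_const.mul (h1.sub contDiff_const))

theorem bump_norm_le (ζ : Euc (d + 1)) (r : ℝ) (m : ℕ) (x : Euc (d + 1)) :
    ‖bump ζ r m x‖ ≤ 1 := by
  rw [bump, Real.norm_eq_abs, abs_of_nonneg (Real.smoothTransition.nonneg _)]
  exact Real.smoothTransition.le_one _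

theorem bump_tendsto (ζ : Euc (d + 1)) (r : ℝ) (x : Euc (d + 1)) :
    Tendsto (fun m => bump ζ r m x) atTop
      (𝓝 ({y : Euc (d + 1) | Real.cos r < ⟪ζ, y⟫}.indicator (fun _ => (1 : ℝ)) x)) := by
  by_cases h : Real.cos r < ⟪ζ, x⟫
  · rw [Set.indicator_of_mem (by exact h)]
    have hp : 0 < ⟪ζ, x⟫ - Real.cos r := by linarith
    have ht : Tendsto (fun m : ℕ => (m : ℝ) * (⟪ζ, x⟫ - Real.cos r)) atTop atTop :=
      tendsto_natCast_atTop_atTop.atTop_mul_const hp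
    refine tendsto_const_nhds.congr' ?_
    filter_upwards [ht.eventually_ge_atTop 1] with m hm
    exact (Real.smoothTransition.one_of_one_le hm).symm
  · rw [Set.indicator_of_notMem (by exact h)]
    refine tendsto_const_nhds.congr fun m => ?_
    refine (Real.smoothTransition.zero_of_nonpos ?_).symm
    exact mul_nonpos_of_nonneg_of_nonpos (Nat.cast_nonneg _) (by linarith [not_lt.1 h])

theorem bump_integral_tendsto (hξ : ‖ξ‖ = 1) (hv : ‖v‖ = 1)
    (hvξ : ⟪v, ξ⟫ = 0) {F : Sph d → ℝ} (hF : Integrable F (sphMeasure d)) (ζ : Sph d) {r : ℝ}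
    (h0 : 0 ≤ r) (hr : r ≤ Real.pi) (s : ℝ) :
    Tendsto (fun m => ∫ η : Sph d, F η * bump (ζ : Euc (d + 1)) r m (rotR ξ v (-s) η)
      ∂(sphMeasure d)) atTop
      (𝓝 (∫ η in gball (rotE ξ v hξ hv hvξ s ζ) r, F η ∂(sphMeasure d))) := by
  rw [← integral_indicator (gball_measurable _ h0 hr)]
  refine tendsto_integral_filter_of_dominated_convergence (fun η => ‖F η‖)
    (Eventually.of_forall fun m => ?_)
    (Eventually.of_forall fun m => Eventually.of_forall fun η => ?_) hF.norm
    (Eventually.of_forall fun η => ?_)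
  · exact (integrable_smul_cont hF ((bump_contDiff _ r m).continuous.comp
      ((rotR_contDiff (-s)).continuous.comp continuous_subtype_val))).1
  · rw [norm_mul]
    exact mul_le_of_le_one_right (norm_nonneg _) (bump_norm_le _ _ _ _)
  · have h := (bump_tendsto (ζ : Euc (d + 1)) r (rotR ξ v (-s) η)).const_mul (F η)
    convert h using 2
    rw [gball_eq _ h0 hr]
    have e : ⟪(ζ : Euc (d + 1)), rotR ξ v (-s) η⟫ =
        ⟪((rotE ξ v hξ hv hvξ s ζ : Sph d) : Euc (d + 1)), (η : Euc (d + 1))⟫ :=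
      (rotR_adjoint s _ _).symm
    simp only [Set.indicator_apply, Set.mem_ofPred_eq, e]
    split_ifs <;> simp

theorem ball_rot_integral (hf : MemW11 f g) (hξ : ‖ξ‖ = 1) (hv : ‖v‖ = 1)
    (hvξ : ⟪v, ξ⟫ = 0) (ζ : Sph d) {r : ℝ} (h0 : 0 ≤ r) (hr : r ≤ Real.pi) (t : ℝ) :
    ∫ s in (0:ℝ)..t, (∫ η in gball (rotE ξ v hξ hv hvξ s ζ) r, ⟪g η, rotA ξ v η⟫ ∂(sphMeasure d)) =
      (∫ η in gball (rotE ξ v hξ hv hvξ t ζ) r, f η ∂(sphMeasure d)) -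
        ∫ η in gball (rotE ξ v hξ hv hvξ 0 ζ) r, f η ∂(sphMeasure d) := by
  have hh : Integrable (fun η : Sph d => ⟪g η, rotA ξ v η⟫) (sphMeasure d) :=
    integrable_inner_cont hf.2.1 (rotA_continuous.comp continuous_subtype_val)
  have hL := (bump_integral_tendsto hξ hv hvξ hf.1 ζ h0 hr t).sub
    (bump_integral_tendsto hξ hv hvξ hf.1 ζ h0 hr 0)
  refine tendsto_nhds_unique ?_ hL
  have hs := fun m => smooth_rot_integral hf hξ hv hvξ (bump_contDiff (ζ : Euc (d + 1)) r m)
  simp only [← (hs _).2]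
  refine intervalIntegral.tendsto_integral_filter_of_dominated_convergence
    (fun _ => ∫ η, ‖⟪g η, rotA ξ v η⟫‖ ∂(sphMeasure d))
    (Eventually.of_forall fun m => (hs m).1.aestronglyMeasurable)
    (Eventually.of_forall fun m => Eventually.of_forall fun s _ => ?_)
    intervalIntegrable_const
    (Eventually.of_forall fun s _ => bump_integral_tendsto hξ hv hvξ hh ζ h0 hr s)
  refine norm_integral_le_of_norm_le hh.norm (Eventually.of_forall fun η => ?_)
  rw [norm_mul]
  exact mul_le_of_le_one_right (norm_nonneg _) (bump_norm_le _ _ _ _)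

theorem ball_integral_eq (hξ : ‖ξ‖ = 1) (hv : ‖v‖ = 1) (hvξ : ⟪v, ξ⟫ = 0) (h : Sph d → ℝ)
    (ζ : Sph d) (r : ℝ) (s : ℝ) :
    ∫ η in gball (rotE ξ v hξ hv hvξ s ζ) r, h η ∂(sphMeasure d) =
      ∫ η in gball ζ r, h (rotE ξ v hξ hv hvξ s η) ∂(sphMeasure d) := by
  rw [← (rotE_mp ξ v hξ hv hvξ s).setIntegral_preimage_emb
    (rotE ξ v hξ hv hvξ s).toHomeomorph.measurableEmbedding, rotE_preimage]

theorem ball_integral_continuous (hξ : ‖ξ‖ = 1) (hv : ‖v‖ = 1) (hvξ : ⟪v, ξ⟫ = 0) {h : Sph d → ℝ}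
    (hh : Integrable h (sphMeasure d)) (ζ : Sph d) (r : ℝ) :
    Continuous (fun s : ℝ =>
      ∫ η in gball (rotE ξ v hξ hv hvξ s ζ) r, h η ∂(sphMeasure d)) := by
  refine continuous_of_uniform_approx_of_continuous fun u hu => ?_
  obtain ⟨ε, hε, hεu⟩ := Metric.mem_uniformity_dist.1 hu
  obtain ⟨k, hk, hki⟩ := hh.exists_boundedContinuous_integral_sub_le (half_pos hε)
  refine ⟨fun s => ∫ η in gball (rotE ξ v hξ hv hvξ s ζ) r, k η ∂(sphMeasure d), ?_, fun s => ?_⟩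
  · simp only [ball_integral_eq]
    refine continuous_of_dominated (bound := fun _ => ‖k‖) (fun s => ?_)
      (fun s => Eventually.of_forall fun η => k.norm_coe_le_norm _) (integrable_const _)
      (Eventually.of_forall fun η => ?_)
    · exact (k.continuous.comp (rotE ξ v hξ hv hvξ s).continuous).aestronglyMeasurable
    · refine k.continuous.comp (Continuous.subtype_mk ?_ _)
      exact rotR_continuous.comp (continuous_id.prodMk continuous_const)
  · apply hεu
    rw [dist_eq_norm, ← integral_sub hh.integrableOn hki.integrableOn]
    refine lt_of_le_of_lt (norm_integral_le_integral_norm _) ?_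
    refine lt_of_le_of_lt (setIntegral_le_integral (hh.sub hki).norm
      (Eventually.of_forall fun η => norm_nonneg _)) ?_
    exact lt_of_le_of_lt hk (half_lt_self hε)

theorem ball_hasDerivAt (hf : MemW11 f g) (hξ : ‖ξ‖ = 1) (hv : ‖v‖ = 1)
    (hvξ : ⟪v, ξ⟫ = 0) (ζ : Sph d) {r : ℝ} (h0 : 0 ≤ r) (hr : r ≤ Real.pi) :
    HasDerivAt (fun t => ∫ η in gball (rotE ξ v hξ hv hvξ t ζ) r, f η ∂(sphMeasure d))
      (∫ η in gball ζ r, ⟪g η, rotA ξ v η⟫ ∂(sphMeasure d)) 0 := by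
  have hh : Integrable (fun η : Sph d => ⟪g η, rotA ξ v η⟫) (sphMeasure d) :=
    integrable_inner_cont hf.2.1 (rotA_continuous.comp continuous_subtype_val)
  have hz : rotE ξ v hξ hv hvξ 0 ζ = ζ := Subtype.ext (rotR_zero _)
  have hc := ball_integral_continuous hξ hv hvξ hh ζ r
  have h1 := (intervalIntegral.integral_hasStrictDerivAt_right (hc.intervalIntegrable 0 0)
    hc.stronglyMeasurable.stronglyMeasurableAtFilter hc.continuousAt).hasDerivAt
  have h2 := h1.add_const (∫ η in gball (rotE ξ v hξ hv hvξ 0 ζ) r, f η ∂(sphMeasure d))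
  simp only [ball_rot_integral hf hξ hv hvξ ζ h0 hr, sub_add_cancel, hz] at h2
  exact h2

end derivs

/-! ### The maximal function along rotations -/

theorem sphMax_nonneg {d : ℕ} (β : ℝ) (f : Sph d → ℝ) (ξ : Sph d) : 0 ≤ sphMax β f ξ := by
  apply Real.sSup_nonneg
  rintro a ⟨ζ, r, hr, -, -, rfl⟩
  refine mul_nonneg (Real.rpow_nonneg hr.le _) ?_
  rw [setAverage_eq]
  exact smul_nonneg (by positivity) (integral_nonneg fun η => abs_nonneg _)

theorem grad_along {d : ℕ} {u : Sph d → ℝ} {G : Euc (d + 1)} {ξ : Sph d} {v : Euc (d + 1)}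
    (hu : HasSphereGradAt u G ξ) (hξ : ‖(ξ : Euc (d + 1))‖ = 1) (hv : ‖v‖ = 1)
    (hvξ : ⟪v, (ξ : Euc (d + 1))⟫ = 0) :
    HasDerivAt (fun t => u (rotE (ξ : Euc (d + 1)) v hξ hv hvξ t ξ)) ⟪G, v⟫ 0 := by
  have hz : rotE (ξ : Euc (d + 1)) v hξ hv hvξ 0 ξ = ξ := Subtype.ext (rotR_zero _)
  have hA : rotA (ξ : Euc (d + 1)) v ξ = v := by
    rw [rotA, real_inner_comm, hvξ, real_inner_self_eq_norm_sq, hξ]; simp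
  have hγ := rotR_hasDerivAt hξ hv hvξ 0 (ξ : Euc (d + 1))
  rw [rotR_zero, hA] at hγ
  have hcont : Tendsto (fun t => rotE (ξ : Euc (d + 1)) v hξ hv hvξ t ξ) (𝓝 0) (𝓝 ξ) := by
    rw [tendsto_subtype_rng]
    have := hγ.continuousAt.tendsto
    rwa [rotR_zero] at this
  have h1 := hu.2.comp_tendsto hcont
  have h2 : (fun t => dist (rotE (ξ : Euc (d + 1)) v hξ hv hvξ t ξ) ξ) =O[𝓝 0] fun t : ℝ => t := by
    have := hγ.isBigO_sub
    rw [rotR_zero] at this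
    refine IsBigO.trans (IsBigO.of_norm_left ?_) (this.congr_right fun t => by simp)
    refine IsBigO.of_bound 1 (Eventually.of_forall fun t => ?_)
    rw [norm_norm, one_mul, Subtype.dist_eq, dist_eq_norm, norm_norm]
    exact le_rfl
  have h3 := h1.trans_isBigO h2
  have hG : HasDerivAt (fun t => ⟪G, rotR (ξ : Euc (d + 1)) v t ξ⟫) ⟪G, v⟫ 0 :=
    (innerSL ℝ G).hasFDerivAt.comp_hasDerivAt (0 : ℝ) hγ
  rw [hasDerivAt_iff_isLittleO] at hG ⊢
  simp only [sub_zero, rotR_zero] at hG ⊢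
  refine (h3.add hG).congr_left fun t => ?_
  simp only [Function.comp_apply, hz, inner_sub_right]
  have : ⟪G, ((rotE (ξ : Euc (d + 1)) v hξ hv hvξ t ξ : Sph d) : Euc (d + 1))⟫ =
    ⟪G, rotR (ξ : Euc (d + 1)) v t ξ⟫ := rfl
  rw [this]
  ring

theorem unit_formula {d : ℕ} {β : ℝ} (hβ0 : 0 < β)
    {f : Sph d → ℝ} {g : Sph d → Euc (d + 1)}
    (hf : MemW11 f g) (hnn : ∀ ξ, 0 ≤ f ξ)
    {ξ ζ : Sph d} {r : ℝ} {G : Euc (d + 1)}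
    (hball : IsBestBall β f ξ ζ r)
    (hdiff : HasSphereGradAt (sphMax β f) G ξ) (v : Euc (d + 1)) (hv : ‖v‖ = 1)
    (hvξ : ⟪v, (ξ : Euc (d + 1))⟫ = 0) :
    ⟪G, v⟫ = r ^ β * ⨍ η in gball ζ r, ⟪g η, rotA (ξ : Euc (d + 1)) v η⟫ ∂(sphMeasure d) := by
  obtain ⟨h0, hr, hmem, hval⟩ := hball
  have hξ : ‖(ξ : Euc (d + 1))‖ = 1 := mem_sphere_zero_iff_norm.1 ξ.2
  set E := rotE (ξ : Euc (d + 1)) v hξ hv hvξ with hE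
  have hzξ : E 0 ξ = ξ := Subtype.ext (rotR_zero _)
  have hzζ : E 0 ζ = ζ := Subtype.ext (rotR_zero _)
  set c : ℝ := r ^ β * ((sphMeasure d).real (gball ζ r))⁻¹ with hc
  have hc0 : 0 ≤ c := mul_nonneg (Real.rpow_nonneg h0 _) (by positivity)
  have hL := (ball_hasDerivAt hf hξ hv hvξ ζ h0 hr).const_mul c
  have hU := grad_along hdiff hξ hv hvξ
  simp only [← hE] at hL hU
  have habs : (fun η => |f η|) = f := funext fun η => abs_of_nonneg (hnn η)
  rw [habs, setAverage_eq, smul_eq_mul, ← mul_assoc] at hval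
  rw [setAverage_eq, smul_eq_mul, ← mul_assoc]
  by_cases hu : sphMax β f ξ = 0
  · have hm1 : IsLocalMin (fun t => sphMax β f (E t ξ)) 0 := by
      refine Eventually.of_forall fun t => ?_
      simp only [hzξ, hu]
      exact sphMax_nonneg _ _ _
    have hm2 : IsLocalMin (fun t => c * ∫ η in gball (E t ζ) r, f η ∂(sphMeasure d)) 0 := by
      refine Eventually.of_forall fun t => ?_
      simp only [hzζ]
      rw [← hval, hu]
      exact mul_nonneg hc0 (integral_nonneg fun η => hnn η)
    rw [hm1.hasDerivAt_eq_zero hU, hm2.hasDerivAt_eq_zero hL]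
  · have hpos : 0 < sphMax β f ξ := lt_of_le_of_ne (sphMax_nonneg _ _ _) (Ne.symm hu)
    have hrpos : 0 < r := by
      refine lt_of_le_of_ne h0 fun h => hu ?_
      rw [hval, ← h, Real.zero_rpow hβ0.ne']
      simp
    have hev : ∀ᶠ t in 𝓝 (0 : ℝ), 0 < sphMax β f (E t ξ) := by
      refine hU.continuousAt.eventually (lt_mem_nhds ?_)
      simpa only [hzξ] using hpos
    have hm : IsLocalMin (fun t => sphMax β f (E t ξ) -
        c * ∫ η in gball (E t ζ) r, f η ∂(sphMeasure d)) 0 := by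
      filter_upwards [hev] with t ht
      simp only [hzξ, hzζ]
      rw [← hval, sub_self, sub_nonneg]
      refine le_csSup ?_ ⟨E t ζ, r, hrpos, hr, ?_, ?_⟩
      · by_contra hb
        rw [sphMax, Real.sSup_of_not_bddAbove hb] at ht
        exact lt_irrefl _ ht
      · have : geodist (E t ζ) (E t ξ) = geodist ζ ξ :=
          congrArg Real.arccos (rotR_inner hξ hv hvξ t _ _)
        rw [this]; exact hmem
      · have hmeas : (sphMeasure d).real (gball (E t ζ) r) = (sphMeasure d).real (gball ζ r) := by
          rw [Measure.real, Measure.real,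
            ← (rotE_mp (ξ : Euc (d + 1)) v hξ hv hvξ t).measure_preimage
              (gball_measurable (E t ζ) h0 hr).nullMeasurableSet, hE, rotE_preimage]
        rw [habs, setAverage_eq, smul_eq_mul, ← mul_assoc, hmeas]
    have := hm.hasDerivAt_eq_zero (hU.sub hL)
    linarith

/-- **Luiro-type formula.** If `f ∈ W^{1,1}_pol(𝕊^d)` is nonnegative, `𝓜̃_β f` is
differentiable at `ξ` (with gradient `G`) and `B̄(ζ,r) ∈ 𝐁_ξ^β`, then for every `v ⊥ ξ`,
`∇𝓜̃_β f(ξ)·v = r^β ⨍_B ∇f(η)·(-(η·v)ξ + (η·ξ)v) dσ(η)`, and in particular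
`|∇𝓜̃_β f(ξ)| ≤ r^β ⨍_B |∇f| dσ`. -/
theorem gradient_formula_best_ball (d : ℕ) (hd : 1 ≤ d) (β : ℝ) (hβ0 : 0 < β) (hβd : β < d)
    (f : Sph d → ℝ) (g : Sph d → Euc (d + 1))
    (hf : MemW11 f g) (hfpol : IsPolar f) (hnn : ∀ ξ, 0 ≤ f ξ)
    (ξ ζ : Sph d) (r : ℝ) (G : Euc (d + 1))
    (hball : IsBestBall β f ξ ζ r)
    (hdiff : HasSphereGradAt (sphMax β f) G ξ) :
    (∀ v : Euc (d + 1), ⟪v, (ξ : Euc (d + 1))⟫ = 0 →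
      ⟪G, v⟫ = r ^ β * ⨍ η in gball ζ r,
        ⟪g η, -(⟪(η : Euc (d + 1)), v⟫) • (ξ : Euc (d + 1)) +
          ⟪(η : Euc (d + 1)), (ξ : Euc (d + 1))⟫ • v⟫ ∂(sphMeasure d)) ∧
    ‖G‖ ≤ r ^ β * ⨍ η in gball ζ r, ‖g η‖ ∂(sphMeasure d) := by
  have hξ : ‖(ξ : Euc (d + 1))‖ = 1 := mem_sphere_zero_iff_norm.1 ξ.2
  have main : ∀ v : Euc (d + 1), ⟪v, (ξ : Euc (d + 1))⟫ = 0 →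
      ⟪G, v⟫ = r ^ β * ⨍ η in gball ζ r, ⟪g η, rotA (ξ : Euc (d + 1)) v η⟫ ∂(sphMeasure d) := by
    intro v hvξ
    by_cases hv0 : v = 0
    · simp [hv0, rotA]
    have hvp : ‖v‖ ≠ 0 := norm_ne_zero_iff.2 hv0
    have h := unit_formula hβ0 hf hnn hball hdiff (‖v‖⁻¹ • v) (by
      rw [norm_smul, norm_inv, norm_norm, inv_mul_cancel₀ hvp])
      (by rw [real_inner_smul_left, hvξ, mul_zero])
    have e : ∀ η : Sph d, ⟪g η, rotA (ξ : Euc (d + 1)) (‖v‖⁻¹ • v) η⟫ =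
        ‖v‖⁻¹ * ⟪g η, rotA (ξ : Euc (d + 1)) v η⟫ := by
      intro η
      simp only [rotA, inner_add_right, real_inner_smul_right]
      ring
    simp only [e, setAverage_eq, integral_const_mul, real_inner_smul_right, smul_eq_mul] at h
    rw [setAverage_eq, smul_eq_mul]
    have h2 := congrArg (fun z => ‖v‖ * z) h
    rw [← mul_assoc, mul_inv_cancel₀ hvp, one_mul] at h2
    rw [h2]
    field_simp
  refine ⟨main, ?_⟩
  have hr0 : 0 ≤ r ^ β := Real.rpow_nonneg hball.1 _
  have hc0 : 0 ≤ ((sphMeasure d).real (gball ζ r))⁻¹ := by positivity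
  have hG := main G hdiff.1
  have hgi := hf.2.1
  have hle : ∫ η in gball ζ r, ⟪g η, rotA (ξ : Euc (d + 1)) G η⟫ ∂(sphMeasure d) ≤
      ∫ η in gball ζ r, ‖g η‖ * ‖G‖ ∂(sphMeasure d) := by
    refine integral_mono (integrable_inner_cont hgi
      (rotA_continuous.comp continuous_subtype_val)).integrableOn
      (hgi.norm.mul_const _).integrableOn (fun η => ?_)
    refine (real_inner_le_norm _ _).trans ?_
    gcongr
    exact rotA_norm_le hξ hdiff.1 _ (mem_sphere_zero_iff_norm.1 η.2)
  rw [integral_mul_const] at hle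
  rw [setAverage_eq, smul_eq_mul] at hG ⊢
  rw [real_inner_self_eq_norm_sq] at hG
  have hfin : ‖G‖ ^ 2 ≤ (r ^ β * (((sphMeasure d).real (gball ζ r))⁻¹ *
      ∫ η in gball ζ r, ‖g η‖ ∂(sphMeasure d))) * ‖G‖ := by
    rw [hG]
    calc _ ≤ r ^ β * (((sphMeasure d).real (gball ζ r))⁻¹ *
        ((∫ η in gball ζ r, ‖g η‖ ∂(sphMeasure d)) * ‖G‖)) := by gcongr
      _ = _ := by ring
  rcases eq_or_lt_of_le (norm_nonneg G) with h | h
  · rw [← h]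
    exact mul_nonneg hr0 (mul_nonneg hc0 (integral_nonneg fun η => norm_nonneg _))
  · rw [sq] at hfin
    exact le_of_mul_le_mul_right hfin h

end
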